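/- arXiv:2605.29469 — 5 statements merged into one kernel-verified Lean document; each statement's English description precedes it below -/
import Mathlib

section
/- Let β ∈ (0,1), μ > 0, α ≥ 0, κ₀ ∈ (0,1), and let ĝ : ℝ × ℝ → ℂ be measurable. Suppose there exist θ* ∈ (0,1] and C₀ > 0 such that for all x, y ∈ ℝ, ∫_ℝ |ĝ(λ,x) − ĝ(λ,y)|² (1 + λ²)^{−α} |λ|^{κ₀−1} dλ ≤ C₀ |x − y|^{2θ*}. Then for every fixed t > 0 there exists C > 0 such that for all x, y ∈ ℝ, ∫_ℝ |ĝ(λ,x) − ĝ(λ,y)|² (E_β(−μ t^β |λ|^α))² |λ|^{κ₀−1} dλ ≤ C |x − y|^{2θ*}. (This expresses, via the Itô isometry, that the limit field Ũ₀^g(t,x) of Theorem 3.2 is mean-square Hölder continuous in the spatial variable of any order γ_x ∈ (0,θ*).) -/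
open Real MeasureTheory

/-- The Mittag-Leffler function `E_β(s) = ∑_{k=0}^∞ s^k / Γ(1 + βk)`. -/
noncomputable def mittagLeffler (β s : ℝ) : ℝ :=
  ∑' k : ℕ, s ^ k / Real.Gamma (1 + β * k)

open Filter Topology PowerSeries

/-- The recurrence of the Taylor coefficients of `(1 - X) ^ (-s)`. -/
lemma succ_mul_multichoose_succ (s : ℝ) (n : ℕ) :
    ((n : ℝ) + 1) * Ring.multichoose s (n + 1) = (s + n) * Ring.multichoose s n := by
  have h1 := Ring.factorial_nsmul_multichoose_eq_ascPochhammer s n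
  have h2 := Ring.factorial_nsmul_multichoose_eq_ascPochhammer s (n + 1)
  rw [Polynomial.ascPochhammer_smeval_eq_eval, nsmul_eq_mul] at h1 h2
  rw [ascPochhammer_succ_eval, ← h1, Nat.factorial_succ] at h2
  push_cast at h2
  have h3 : (n.factorial : ℝ) ≠ 0 := by positivity
  apply mul_left_cancel₀ h3
  linarith

lemma multichoose_succ_eq (s : ℝ) (n : ℕ) :
    Ring.multichoose s (n + 1) = (s + n) / (n + 1) * Ring.multichoose s n := by
  have := succ_mul_multichoose_succ s n
  have h : (n : ℝ) + 1 ≠ 0 := by positivity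
  field_simp
  linarith

lemma multichoose_pos {s : ℝ} (hs : 0 < s) (n : ℕ) : 0 < Ring.multichoose s n := by
  induction n with
  | zero => simp
  | succ n ih => rw [multichoose_succ_eq]; positivity

lemma multichoose_antitone {s : ℝ} (hs : 0 < s) (hs1 : s ≤ 1) :
    Antitone (Ring.multichoose s) := by
  refine antitone_nat_of_succ_le fun n => ?_
  rw [multichoose_succ_eq]
  refine mul_le_of_le_one_left (multichoose_pos hs n).le ?_
  rw [div_le_one (by positivity)]
  linarith

lemma multichoose_neg_nonpos {s : ℝ} (hs : 0 < s) (hs1 : s < 1) (n : ℕ) :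
    Ring.multichoose (-s) (n + 1) ≤ 0 := by
  induction n with
  | zero => simp [hs.le]
  | succ n ih =>
    rw [multichoose_succ_eq]
    push_cast
    refine mul_nonpos_of_nonneg_of_nonpos (div_nonneg ?_ (by positivity)) ih
    have : (0 : ℝ) ≤ n := n.cast_nonneg
    linarith

/-- The formal power series `(1 - X) ^ (-s)`. -/
noncomputable def oneSubPowNeg (s : ℝ) : ℝ⟦X⟧ := PowerSeries.mk (Ring.multichoose s)

@[simp]
lemma coeff_oneSubPowNeg (s : ℝ) (n : ℕ) :
    coeff n (oneSubPowNeg s) = Ring.multichoose s n := by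
  simp [oneSubPowNeg]

lemma oneSubPowNeg_eq_rescale (s : ℝ) :
    oneSubPowNeg s = rescale (-1 : ℝ) (binomialSeries ℝ (-s)) := by
  ext n
  rw [coeff_rescale, binomialSeries_coeff, Ring.choose_neg, coeff_oneSubPowNeg,
    Ring.multichoose_eq]
  simp [Units.smul_def, ← mul_assoc, ← mul_pow]

lemma oneSubPowNeg_add (s r : ℝ) :
    oneSubPowNeg (s + r) = oneSubPowNeg s * oneSubPowNeg r := by
  simp only [oneSubPowNeg_eq_rescale, ← map_mul, ← binomialSeries_add, neg_add]

lemma oneSubPowNeg_zero : oneSubPowNeg 0 = 1 := by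
  simp [oneSubPowNeg_eq_rescale]

lemma Gamma_add_nat_eq {s : ℝ} (hs : 0 < s) (n : ℕ) :
    Gamma (s + n) = Ring.multichoose s n * n.factorial * Gamma s := by
  induction n with
  | zero => simp
  | succ n ih =>
    have h := succ_mul_multichoose_succ s n
    push_cast
    rw [← add_assoc, Gamma_add_one (by positivity), ih, Nat.factorial_succ]
    push_cast
    linear_combination (-(n.factorial : ℝ) * Gamma s) * h

lemma rpow_mul_exp_neg_le_Gamma {s y : ℝ} (hs : 0 ≤ s) (hy : 0 ≤ y) :
    y ^ s * exp (-y) ≤ Gamma (1 + s) := by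
  have hi := Real.GammaIntegral_convergent (s := 1 + s) (by linarith)
  rw [Gamma_eq_integral (by linarith)]
  have hsub : Set.Ioi y ⊆ Set.Ioi 0 := Set.Ioi_subset_Ioi hy
  calc y ^ s * exp (-y) = ∫ x in Set.Ioi y, exp (-x) * y ^ s := by
        rw [integral_mul_const, integral_exp_neg_Ioi, mul_comm]
    _ ≤ ∫ x in Set.Ioi y, exp (-x) * x ^ (1 + s - 1) := by
        refine setIntegral_mono_on ?_ (hi.mono_set hsub) measurableSet_Ioi fun x hx => ?_
        · exact (integrableOn_exp_neg_Ioi y).mul_const _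
        · have : y ^ s ≤ x ^ s := rpow_le_rpow hy (le_of_lt hx) hs
          simp only [add_sub_cancel_left]
          gcongr
    _ ≤ ∫ x in Set.Ioi 0, exp (-x) * x ^ (1 + s - 1) := by
        refine setIntegral_mono_set hi ?_ hsub.eventuallyLE
        filter_upwards [ae_restrict_mem measurableSet_Ioi] with x hx
        have : (0 : ℝ) < x := hx
        simp only [Pi.zero_apply]
        positivity

/-- A binomial-type bound on the coefficients of `(1 - X) ^ (-(1 + s))`. -/
lemma multichoose_one_add_le {s ρ : ℝ} (hs : 0 ≤ s) (hρ : 0 < ρ) (hρ1 : ρ < 1) (n : ℕ) :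
    Ring.multichoose (1 + s) n ≤ (ρ ^ s)⁻¹ * ((1 - ρ) ^ (n + 1))⁻¹ := by
  have hG : 0 < Gamma (1 + s) := Gamma_pos_of_pos (by linarith)
  have hρ2 : 0 < 1 - ρ := by linarith
  have key : ρ ^ s * Gamma (1 + s + n) ≤
      Gamma (1 + s) * ((1 / (1 - ρ)) ^ ((n : ℝ) + 1) * Gamma (n + 1)) := by
    have hI1 := Real.GammaIntegral_convergent (s := 1 + s + n) (by positivity)
    rw [Gamma_eq_integral (s := 1 + s + n) (by positivity),
      ← integral_rpow_mul_exp_neg_mul_Ioi (by positivity) hρ2, ← integral_const_mul,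
      ← integral_const_mul]
    refine setIntegral_mono_on (hI1.const_mul _) ?_ measurableSet_Ioi fun x hx => ?_
    · have := integrableOn_rpow_mul_exp_neg_mul_rpow (s := n) (p := 1) (b := 1 - ρ)
        (by have : (0 : ℝ) ≤ n := n.cast_nonneg
            linarith) zero_lt_one hρ2
      simp only [rpow_one] at this
      simpa only [IntegrableOn, neg_mul, add_sub_cancel_right] using this.const_mul (Gamma (1 + s))
    · have hx0 : (0 : ℝ) < x := hx
      have h := rpow_mul_exp_neg_le_Gamma hs (mul_pos hρ hx0).le
      rw [mul_rpow hρ.le hx0.le] at h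
      have e1 : x ^ (1 + s + n - 1) = x ^ s * x ^ (n : ℝ) := by
        rw [← rpow_add hx0]; ring_nf
      have e2 : exp (-x) = exp (-(ρ * x)) * exp (-((1 - ρ) * x)) := by
        rw [← exp_add]; ring_nf
      rw [e1, e2, add_sub_cancel_right]
      calc _ = (ρ ^ s * x ^ s * exp (-(ρ * x))) * (x ^ (n : ℝ) * exp (-((1 - ρ) * x))) := by ring
        _ ≤ _ := by gcongr
  rw [Gamma_add_nat_eq (by linarith), Gamma_nat_eq_factorial] at key
  have e : (1 / (1 - ρ)) ^ ((n : ℝ) + 1) = ((1 - ρ) ^ (n + 1))⁻¹ := by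
    rw [← Nat.cast_add_one, rpow_natCast, one_div, inv_pow]
  rw [e] at key
  have hf : (0 : ℝ) < n.factorial := by positivity
  have hr : 0 < ρ ^ s := by positivity
  rw [inv_mul_eq_div, le_div_iff₀ hr]
  refine le_of_mul_le_mul_right ?_ (mul_pos hf hG)
  linarith

lemma multichoose_mul_rpow_tendsto {s : ℝ} (hs : 0 < s) :
    Tendsto (fun n : ℕ => Ring.multichoose s n * ((n : ℝ) ^ (s - 1))⁻¹) atTop
      (𝓝 (Gamma s)⁻¹) := by
  have hprod : ∀ n : ℕ, ∏ j ∈ Finset.range n, (s + j) = Ring.multichoose s n * n.factorial := by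
    intro n
    induction n with
    | zero => simp
    | succ n ih =>
      rw [Finset.prod_range_succ, ih, Nat.factorial_succ]
      have h := succ_mul_multichoose_succ s n
      push_cast
      linear_combination (-(n.factorial : ℝ)) * h
  have h1 := (GammaSeq_tendsto_Gamma s).inv₀ (Gamma_pos_of_pos hs).ne'
  have h2 : Tendsto (fun n : ℕ => (n : ℝ) / (n + s)) atTop (𝓝 1) :=
    tendsto_natCast_div_add_atTop s
  have h3 := h2.mul h1
  rw [one_mul] at h3
  refine h3.congr' ?_
  filter_upwards [eventually_gt_atTop 0] with n hn
  have hn0 : (0 : ℝ) < n := by exact_mod_cast hn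
  have hp : 0 < (n : ℝ) ^ s := by positivity
  have hns : (n : ℝ) + s ≠ 0 := by positivity
  have hf : (n.factorial : ℝ) ≠ 0 := by positivity
  rw [GammaSeq, Finset.prod_range_succ, hprod, rpow_sub_one hn0.ne']
  field_simp
  ring

/-- The average of `E_β(-l s ^ β)` over a Gamma distributed `s` with shape `n + 1`;
equivalently, the coefficients of `(1 - X) ^ (β - 1) / ((1 - X) ^ β + l)`. -/
noncomputable def discreteMittagLeffler (β l : ℝ) (n : ℕ) : ℝ :=
  ∑' k : ℕ, (-l) ^ k * Ring.multichoose (1 + β * k) n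

section Discrete

variable {β l ρ : ℝ}

lemma norm_discreteMittagLeffler_term_le (hβ : 0 < β) (hρ : 0 < ρ) (hρ1 : ρ < 1) (hl : 0 ≤ l)
    (n k : ℕ) :
    ‖(-l) ^ k * Ring.multichoose (1 + β * k) n‖ ≤
      (l / ρ ^ β) ^ k * ((1 - ρ) ^ (n + 1))⁻¹ := by
  have h := multichoose_one_add_le (s := β * k) (by positivity) hρ hρ1 n
  have h0 : 0 < Ring.multichoose (1 + β * k) n := multichoose_pos (by positivity) n
  rw [norm_mul, norm_pow, norm_neg, Real.norm_of_nonneg hl, Real.norm_of_nonneg h0.le]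
  calc _ ≤ l ^ k * ((ρ ^ (β * k))⁻¹ * ((1 - ρ) ^ (n + 1))⁻¹) := by gcongr
    _ = _ := by
      rw [rpow_mul hρ.le, rpow_natCast, div_pow]
      ring

lemma summable_discreteMittagLeffler (hβ : 0 < β) (hρ : 0 < ρ) (hρ1 : ρ < 1) (hl : 0 ≤ l)
    (hlρ : l < ρ ^ β) (n : ℕ) :
    Summable fun k : ℕ => (-l) ^ k * Ring.multichoose (1 + β * k) n := by
  have hr : 0 < ρ ^ β := by positivity
  refine Summable.of_norm_bounded ?_ (norm_discreteMittagLeffler_term_le hβ hρ hρ1 hl n)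
  exact (summable_geometric_of_lt_one (by positivity) ((div_lt_one hr).2 hlρ)).mul_right _

/-- The discrete fractional relaxation equation in integrated form. -/
lemma discreteMittagLeffler_volterra (hβ : 0 < β) (hρ : 0 < ρ) (hρ1 : ρ < 1) (hl : 0 ≤ l)
    (hlρ : l < ρ ^ β) :
    PowerSeries.mk (discreteMittagLeffler β l) +
      PowerSeries.C l * oneSubPowNeg β * PowerSeries.mk (discreteMittagLeffler β l) =
      oneSubPowNeg 1 := by
  have hs := summable_discreteMittagLeffler hβ hρ hρ1 hl hlρ
  ext n
  rw [map_add, mul_assoc, coeff_C_mul, coeff_mul, coeff_mk, coeff_oneSubPowNeg]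
  have h1 : ∑ p ∈ Finset.HasAntidiagonal.antidiagonal n, coeff p.1 (oneSubPowNeg β) *
      coeff p.2 (PowerSeries.mk (discreteMittagLeffler β l)) =
      ∑' k : ℕ, (-l) ^ k * Ring.multichoose (1 + β * (k + 1 : ℕ)) n := by
    simp only [coeff_mk, coeff_oneSubPowNeg, discreteMittagLeffler, ← tsum_mul_left]
    have hsw := Summable.tsum_finsetSum (s := Finset.HasAntidiagonal.antidiagonal n)
      (f := fun (p : ℕ × ℕ) (k : ℕ) =>
        Ring.multichoose β p.1 * ((-l) ^ k * Ring.multichoose (1 + β * k) p.2))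
      fun p _ => (hs p.2).mul_left _
    rw [← hsw]
    refine tsum_congr fun k => ?_
    have e : (1 + β * (k + 1 : ℕ) : ℝ) = β + (1 + β * k) := by push_cast; ring
    have h2 := congrArg (coeff n) (oneSubPowNeg_add β (1 + β * k))
    rw [coeff_mul, coeff_oneSubPowNeg] at h2
    simp only [coeff_oneSubPowNeg] at h2
    rw [e, h2, Finset.mul_sum]
    exact Finset.sum_congr rfl fun p _ => by ring
  rw [h1, discreteMittagLeffler, (hs n).tsum_eq_zero_add, ← tsum_mul_left, add_assoc,
    ← Summable.tsum_add ((summable_nat_add_iff 1).2 (hs n))]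
  · rw [show (fun k : ℕ => (-l) ^ (k + 1) * Ring.multichoose (1 + β * (k + 1 : ℕ)) n +
      l * ((-l) ^ k * Ring.multichoose (1 + β * (k + 1 : ℕ)) n)) = fun _ => 0 from
      funext fun k => by ring]
    simp
  · refine (((summable_nat_add_iff 1).2 (hs n)).mul_left (-1)).congr fun k => ?_
    ring

/-- The discrete fractional relaxation equation in differentiated form. -/
lemma discreteMittagLeffler_caputo (hβ : 0 < β) (hρ : 0 < ρ) (hρ1 : ρ < 1) (hl : 0 ≤ l)
    (hlρ : l < ρ ^ β) :
    oneSubPowNeg (-β) * PowerSeries.mk (discreteMittagLeffler β l) +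
      PowerSeries.C l * PowerSeries.mk (discreteMittagLeffler β l) =
      oneSubPowNeg (1 - β) := by
  have h := discreteMittagLeffler_volterra hβ hρ hρ1 hl hlρ
  have h0 : oneSubPowNeg (-β) * oneSubPowNeg β = 1 := by
    rw [← oneSubPowNeg_add, neg_add_cancel, oneSubPowNeg_zero]
  rw [show 1 - β = -β + 1 by ring, oneSubPowNeg_add, ← h]
  linear_combination
    (-PowerSeries.C l * PowerSeries.mk (discreteMittagLeffler β l)) * h0

lemma oneSubPowNeg_one_mul : oneSubPowNeg 1 * (1 - X) = 1 := by
  have : oneSubPowNeg 1 = PowerSeries.mk 1 := by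
    ext n; simp
  rw [this, mk_one_mul_one_sub_eq_one]

/-- Separate the diagonal term in a coefficient of `(1 - X) ^ β * F`. -/
lemma coeff_succ_oneSubPowNeg_mul (F : ℝ⟦X⟧) (s : ℝ) (n : ℕ) :
    coeff (n + 1) (oneSubPowNeg s * F) = coeff (n + 1) F +
      ∑ i ∈ Finset.range (n + 1), Ring.multichoose s (i + 1) * coeff (n - i) F := by
  rw [coeff_mul, Finset.Nat.sum_antidiagonal_eq_sum_range_succ
    (fun i j => coeff i (oneSubPowNeg s) * coeff j F), Finset.sum_range_succ']
  simp only [coeff_oneSubPowNeg, Nat.sub_zero, Ring.multichoose_zero_right, one_mul,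
    Nat.add_sub_add_right]
  ring

lemma discreteMittagLeffler_zero (hβ : 0 < β) (hρ : 0 < ρ) (hρ1 : ρ < 1) (hl : 0 ≤ l)
    (hlρ : l < ρ ^ β) : discreteMittagLeffler β l 0 * (1 + l) = 1 := by
  have h := congrArg (coeff 0) (discreteMittagLeffler_caputo hβ hρ hρ1 hl hlρ)
  simp [-coeff_zero_eq_constantCoeff, coeff_mul] at h
  linarith

lemma discreteMittagLeffler_nonneg (hβ : 0 < β) (hβ1 : β < 1) (hρ : 0 < ρ) (hρ1 : ρ < 1)
    (hl : 0 ≤ l) (hlρ : l < ρ ^ β) (n : ℕ) : 0 ≤ discreteMittagLeffler β l n := by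
  have hl1 : 0 < 1 + l := by linarith
  induction n using Nat.strong_induction_on with
  | _ n ih =>
    refine nonneg_of_mul_nonneg_left (b := 1 + l) ?_ hl1
    cases n with
    | zero => rw [discreteMittagLeffler_zero hβ hρ hρ1 hl hlρ]; exact zero_le_one
    | succ n =>
      have h := congrArg (coeff (n + 1)) (discreteMittagLeffler_caputo hβ hρ hρ1 hl hlρ)
      rw [map_add, coeff_succ_oneSubPowNeg_mul, coeff_C_mul, coeff_oneSubPowNeg] at h
      simp only [coeff_mk] at h
      have h1 := multichoose_pos (s := 1 - β) (by linarith) (n + 1)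
      have h2 : ∑ i ∈ Finset.range (n + 1),
          Ring.multichoose (-β) (i + 1) * discreteMittagLeffler β l (n - i) ≤ 0 :=
        Finset.sum_nonpos fun i _ => mul_nonpos_of_nonpos_of_nonneg
          (multichoose_neg_nonpos hβ hβ1 i) (ih _ (by omega))
      linarith

lemma coeff_succ_mul_one_sub_X (F : ℝ⟦X⟧) (n : ℕ) :
    coeff (n + 1) (F * (1 - X)) = coeff (n + 1) F - coeff n F := by
  rw [mul_sub, mul_one, map_sub, coeff_succ_mul_X]

lemma discreteMittagLeffler_antitone (hβ : 0 < β) (hβ1 : β < 1) (hρ : 0 < ρ) (hρ1 : ρ < 1)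
    (hl : 0 ≤ l) (hlρ : l < ρ ^ β) : Antitone (discreteMittagLeffler β l) := by
  have hl1 : 0 < 1 + l := by linarith
  have h0 := discreteMittagLeffler_zero hβ hρ hρ1 hl hlρ
  set D : ℝ⟦X⟧ := PowerSeries.mk (discreteMittagLeffler β l) * (1 - X) with hD
  have hDs : ∀ n, coeff (n + 1) D =
      discreteMittagLeffler β l (n + 1) - discreteMittagLeffler β l n := fun n => by
    rw [hD, coeff_succ_mul_one_sub_X, coeff_mk, coeff_mk]
  have hD0 : coeff 0 D = discreteMittagLeffler β l 0 := by
    simp [hD, coeff_mul, mul_sub, -coeff_zero_eq_constantCoeff]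
  have hDeq : oneSubPowNeg (-β) * D + PowerSeries.C l * D = oneSubPowNeg (-β) := by
    have h := discreteMittagLeffler_caputo hβ hρ hρ1 hl hlρ
    have e := oneSubPowNeg_add (-β) 1
    rw [show -β + 1 = 1 - β by ring] at e
    linear_combination (1 - X) * h + (1 - X) * e + oneSubPowNeg (-β) * oneSubPowNeg_one_mul
  have hle : ∀ n, coeff (n + 1) D ≤ 0 := by
    intro n
    induction n using Nat.strong_induction_on with
    | _ n ih =>
      have h := congrArg (coeff (n + 1)) hDeq
      rw [map_add, coeff_succ_oneSubPowNeg_mul, coeff_C_mul, coeff_oneSubPowNeg,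
        Finset.sum_range_succ, Nat.sub_self, hD0] at h
      have h2 : 0 ≤ ∑ i ∈ Finset.range n,
          Ring.multichoose (-β) (i + 1) * coeff (n - i) D := by
        refine Finset.sum_nonneg fun i hi => mul_nonneg_of_nonpos_of_nonpos
          (multichoose_neg_nonpos hβ hβ1 i) ?_
        have hi' := Finset.mem_range.1 hi
        obtain ⟨m, hm⟩ : ∃ m, n - i = m + 1 := ⟨n - i - 1, by omega⟩
        rw [hm]
        exact ih m (by omega)
      have h3 := multichoose_neg_nonpos hβ hβ1 n
      have h4 : discreteMittagLeffler β l 0 ≤ 1 := by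
        have := discreteMittagLeffler_nonneg hβ hβ1 hρ hρ1 hl hlρ 0
        nlinarith
      have h5 := mul_nonneg_of_nonpos_of_nonpos h3 (sub_nonpos.2 h4)
      refine nonpos_of_mul_nonpos_left (b := 1 + l) ?_ hl1
      linarith
  refine antitone_nat_of_succ_le fun n => ?_
  have := hle n
  rw [hDs] at this
  linarith

lemma discreteMittagLeffler_upper (hβ : 0 < β) (hβ1 : β < 1) (hρ : 0 < ρ) (hρ1 : ρ < 1)
    (hl : 0 ≤ l) (hlρ : l < ρ ^ β) (n : ℕ) :
    discreteMittagLeffler β l n * (1 + l * Ring.multichoose (1 + β) n) ≤ 1 := by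
  have h := congrArg (coeff n) (discreteMittagLeffler_volterra hβ hρ hρ1 hl hlρ)
  rw [map_add, mul_assoc, coeff_C_mul, coeff_mul] at h
  simp only [coeff_mk, coeff_oneSubPowNeg, Ring.multichoose_one] at h
  have h2 := congrArg (coeff n) (oneSubPowNeg_add β 1)
  rw [coeff_mul] at h2
  simp only [coeff_oneSubPowNeg, Ring.multichoose_one, mul_one] at h2
  have h3 : (∑ p ∈ Finset.HasAntidiagonal.antidiagonal n, Ring.multichoose β p.1) *
      discreteMittagLeffler β l n ≤
      ∑ p ∈ Finset.HasAntidiagonal.antidiagonal n, Ring.multichoose β p.1 * discreteMittagLeffler β l p.2 := by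
    rw [Finset.sum_mul]
    refine Finset.sum_le_sum fun p hp => mul_le_mul_of_nonneg_left ?_ (multichoose_pos hβ _).le
    exact discreteMittagLeffler_antitone hβ hβ1 hρ hρ1 hl hlρ
      (by have := Finset.HasAntidiagonal.mem_antidiagonal.1 hp
          omega)
  rw [← h2, add_comm β 1] at h3
  have := mul_le_mul_of_nonneg_left h3 hl
  linarith

lemma discreteMittagLeffler_lower (hβ : 0 < β) (hβ1 : β < 1) (hρ : 0 < ρ) (hρ1 : ρ < 1)
    (hl : 0 ≤ l) (hlρ : l < ρ ^ β) (n : ℕ) :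
    Ring.multichoose (1 - β) n ≤
      discreteMittagLeffler β l n * (l + Ring.multichoose (1 - β) n) := by
  set E : ℝ⟦X⟧ := 1 - PowerSeries.mk (discreteMittagLeffler β l) * (1 - X) with hE
  have hanti := discreteMittagLeffler_antitone hβ hβ1 hρ hρ1 hl hlρ
  have h0 := discreteMittagLeffler_zero hβ hρ hρ1 hl hlρ
  have hEs : ∀ n, coeff (n + 1) E =
      discreteMittagLeffler β l n - discreteMittagLeffler β l (n + 1) := fun n => by
    rw [hE, map_sub, coeff_succ_mul_one_sub_X, coeff_mk, coeff_mk, coeff_one]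
    simp
  have hE0 : coeff 0 E = 1 - discreteMittagLeffler β l 0 := by
    simp [hE, coeff_mul, mul_sub, coeff_one, -coeff_zero_eq_constantCoeff]
  have hEnn : ∀ n, 0 ≤ coeff n E := by
    rintro (_ | n)
    · rw [hE0]
      have := discreteMittagLeffler_nonneg hβ hβ1 hρ hρ1 hl hlρ 0
      nlinarith
    · rw [hEs]
      exact sub_nonneg.2 (hanti n.le_succ)
  have hEq : PowerSeries.C l * PowerSeries.mk (discreteMittagLeffler β l) =
      oneSubPowNeg (1 - β) * E := by
    have h := discreteMittagLeffler_caputo hβ hρ hρ1 hl hlρ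
    have e := oneSubPowNeg_add (-β) 1
    rw [show -β + 1 = 1 - β by ring] at e
    rw [hE]
    linear_combination h + (1 - X) * PowerSeries.mk (discreteMittagLeffler β l) * e +
      oneSubPowNeg (-β) * PowerSeries.mk (discreteMittagLeffler β l) * oneSubPowNeg_one_mul
  have hsum : ∀ m, ∑ j ∈ Finset.range (m + 1), coeff j E = 1 - discreteMittagLeffler β l m := by
    intro m
    induction m with
    | zero => simpa using hE0
    | succ m ih => rw [Finset.sum_range_succ, ih, hEs]; ring
  have h := congrArg (coeff n) hEq
  rw [coeff_C_mul, coeff_mk, mul_comm (oneSubPowNeg _), coeff_mul,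
    Finset.Nat.sum_antidiagonal_eq_sum_range_succ
      (fun i j => coeff i E * coeff j (oneSubPowNeg (1 - β)))] at h
  have h2 : (∑ j ∈ Finset.range (n + 1), coeff j E) * Ring.multichoose (1 - β) n ≤
      ∑ j ∈ Finset.range (n + 1), coeff j E * coeff (n - j) (oneSubPowNeg (1 - β)) := by
    rw [Finset.sum_mul]
    refine Finset.sum_le_sum fun j _ => mul_le_mul_of_nonneg_left ?_ (hEnn j)
    rw [coeff_oneSubPowNeg]
    exact multichoose_antitone (by linarith) (by linarith) (Nat.sub_le n j)
  rw [hsum, ← h] at h2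
  linarith

end Discrete

section MittagLeffler

variable {β z : ℝ}

lemma inv_one_sub_pow_le {R : ℝ} {n : ℕ} (hR : 0 < R) (hn : 2 * R < n) :
    ((1 - R / n) ^ (n + 1))⁻¹ ≤ exp (4 * R) := by
  have hn0 : (0 : ℝ) < n := by linarith
  have hn1 : (1 : ℝ) ≤ n := by exact_mod_cast (Nat.cast_pos.1 hn0)
  set ρ := R / n with hρ
  have hρ0 : 0 < ρ := by positivity
  have hρ2 : ρ < 1 / 2 := by rw [hρ, div_lt_iff₀ hn0]; linarith
  have hρ1 : 0 < 1 - ρ := by linarith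
  have h1 : (1 - ρ)⁻¹ ≤ exp (2 * ρ) := by
    rw [inv_le_iff_one_le_mul₀ hρ1]
    have := add_one_le_exp (2 * ρ)
    nlinarith
  rw [← inv_pow]
  calc ((1 - ρ)⁻¹) ^ (n + 1) ≤ exp (2 * ρ) ^ (n + 1) := by gcongr
    _ = exp (2 * ρ * (n + 1)) := by rw [← exp_nat_mul]; push_cast; ring_nf
    _ ≤ exp (4 * R) := by
      have : ρ * n = R := by rw [hρ]; field_simp
      apply exp_le_exp.2
      nlinarith

/-- The parameters for which the discrete approximation of `E_β(-z)` is controlled. -/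
lemma eventually_discrete_parameters (hβ : 0 < β) (hz : 0 ≤ z) : ∃ R : ℝ, 0 < R ∧
    ∀ n : ℕ, 2 * R < n → 0 < R / n ∧ R / n < 1 ∧ 0 ≤ z / (n : ℝ) ^ β ∧
      z / (n : ℝ) ^ β / (R / n) ^ β ≤ 1 / 2 ∧ z / (n : ℝ) ^ β < (R / n) ^ β := by
  refine ⟨(2 * (z + 1)) ^ (1 / β), by positivity, fun n hn => ?_⟩
  set R := (2 * (z + 1)) ^ (1 / β) with hR
  have hR0 : 0 < R := by positivity
  have hn0 : (0 : ℝ) < n := by linarith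
  have hRβ : R ^ β = 2 * (z + 1) := by
    rw [hR, ← rpow_mul (by positivity), one_div, inv_mul_cancel₀ hβ.ne', rpow_one]
  have hnβ : 0 < (n : ℝ) ^ β := by positivity
  have hle : z / (n : ℝ) ^ β / (R / n) ^ β ≤ 1 / 2 := by
    rw [div_rpow hR0.le hn0.le, hRβ, div_div_div_cancel_right₀ hnβ.ne',
      div_le_iff₀ (by positivity)]
    linarith
  refine ⟨by positivity, ?_, by positivity, hle, ?_⟩
  · rw [div_lt_one hn0]
    linarith
  · rw [← div_lt_one (by positivity)]
    linarith

lemma discreteMittagLeffler_tendsto (hβ : 0 < β) (hz : 0 ≤ z) :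
    Tendsto (fun n : ℕ => discreteMittagLeffler β (z / (n : ℝ) ^ β) n) atTop
      (𝓝 (mittagLeffler β (-z))) := by
  obtain ⟨R, hR, hRn⟩ := eventually_discrete_parameters hβ hz
  have hev : ∀ᶠ n : ℕ in atTop, 2 * R < n :=
    tendsto_natCast_atTop_atTop.eventually (eventually_gt_atTop (2 * R))
  refine tendsto_tsum_of_dominated_convergence
    (bound := fun k : ℕ => (1 / 2 : ℝ) ^ k * exp (4 * R)) ?_ (fun k => ?_) ?_
  · exact (summable_geometric_of_lt_one (by norm_num) (by norm_num)).mul_right _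
  · have h := (multichoose_mul_rpow_tendsto (s := 1 + β * k) (by positivity)).const_mul ((-z) ^ k)
    rw [← div_eq_mul_inv] at h
    refine h.congr fun n => ?_
    rw [add_sub_cancel_left, rpow_mul n.cast_nonneg, rpow_natCast, ← neg_div, div_pow]
    ring
  · filter_upwards [hev] with n hn k
    obtain ⟨h1, h2, h3, h4, -⟩ := hRn n hn
    refine (norm_discreteMittagLeffler_term_le hβ h1 h2 h3 n k).trans ?_
    have h5 := inv_one_sub_pow_le hR hn
    have h6 : 0 ≤ z / (n : ℝ) ^ β / (R / n) ^ β := by positivity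
    have h7 : 0 < 1 - R / n := by linarith
    gcongr

lemma mittagLeffler_neg_nonneg (hβ : 0 < β) (hβ1 : β < 1) (hz : 0 ≤ z) :
    0 ≤ mittagLeffler β (-z) := by
  obtain ⟨R, hR, hRn⟩ := eventually_discrete_parameters hβ hz
  refine ge_of_tendsto (discreteMittagLeffler_tendsto hβ hz) ?_
  filter_upwards [tendsto_natCast_atTop_atTop.eventually (eventually_gt_atTop (2 * R))] with n hn
  obtain ⟨h1, h2, h3, -, h5⟩ := hRn n hn
  exact discreteMittagLeffler_nonneg hβ hβ1 h1 h2 h3 h5 n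

/-- `E_β(-z) ≤ 1 / (1 + z / Γ(1 + β))`. -/
lemma mittagLeffler_neg_upper (hβ : 0 < β) (hβ1 : β < 1) (hz : 0 ≤ z) :
    mittagLeffler β (-z) * (1 + z * (Gamma (1 + β))⁻¹) ≤ 1 := by
  obtain ⟨R, hR, hRn⟩ := eventually_discrete_parameters hβ hz
  have hlim := (discreteMittagLeffler_tendsto hβ hz).mul
    (((multichoose_mul_rpow_tendsto (s := 1 + β) (by linarith)).const_mul z).const_add 1)
  refine le_of_tendsto hlim ?_
  filter_upwards [tendsto_natCast_atTop_atTop.eventually (eventually_gt_atTop (2 * R))] with n hn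
  obtain ⟨h1, h2, h3, -, h5⟩ := hRn n hn
  refine (Eq.le ?_).trans (discreteMittagLeffler_upper hβ hβ1 h1 h2 h3 h5 n)
  rw [add_sub_cancel_left]
  ring

/-- `1 / (1 + Γ(1 - β) z) ≤ E_β(-z)`. -/
lemma mittagLeffler_neg_lower (hβ : 0 < β) (hβ1 : β < 1) (hz : 0 ≤ z) :
    1 ≤ mittagLeffler β (-z) * (1 + z * Gamma (1 - β)) := by
  obtain ⟨R, hR, hRn⟩ := eventually_discrete_parameters hβ hz
  have hq := multichoose_mul_rpow_tendsto (s := 1 - β) (by linarith)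
  have hlim := (discreteMittagLeffler_tendsto hβ hz).mul (hq.const_add z)
  have hG : 0 < Gamma (1 - β) := Gamma_pos_of_pos (by linarith)
  have h : (Gamma (1 - β))⁻¹ ≤ mittagLeffler β (-z) * (z + (Gamma (1 - β))⁻¹) := by
    refine le_of_tendsto_of_tendsto hq hlim ?_
    filter_upwards [tendsto_natCast_atTop_atTop.eventually (eventually_gt_atTop (2 * R))]
      with n hn
    obtain ⟨h1, h2, h3, -, h5⟩ := hRn n hn
    have hn0 : (0 : ℝ) < n := by linarith
    have hnβ : 0 < (n : ℝ) ^ β := by positivity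
    have h6 := mul_le_mul_of_nonneg_right
      (discreteMittagLeffler_lower hβ hβ1 h1 h2 h3 h5 n) hnβ.le
    rw [show 1 - β - 1 = -β by ring, rpow_neg hn0.le, inv_inv]
    refine h6.trans_eq ?_
    rw [mul_assoc, add_mul, div_mul_cancel₀ _ hnβ.ne']
  have h7 := mul_le_mul_of_nonneg_right h hG.le
  rw [inv_mul_cancel₀ hG.ne', mul_assoc, add_mul, inv_mul_cancel₀ hG.ne'] at h7
  linarith

end MittagLeffler

/-- Two-sided comparison of `E_β(-w |l| ^ α) ^ 2` with `(1 + l ^ 2) ^ (-α)`. -/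
lemma exists_mittagLeffler_sq_comparable {β w α : ℝ} (hβ : 0 < β) (hβ1 : β < 1) (hw : 0 < w)
    (hα : 0 ≤ α) : ∃ K L : ℝ, 0 < K ∧ 0 < L ∧ ∀ l : ℝ,
      (mittagLeffler β (-(w * |l| ^ α))) ^ 2 ≤ K * (1 + l ^ 2) ^ (-α) ∧
      (1 + l ^ 2) ^ (-α) ≤ L * (mittagLeffler β (-(w * |l| ^ α))) ^ 2 := by
  have hG1 : 0 < Gamma (1 + β) := Gamma_pos_of_pos (by linarith)
  have hG2 : 0 < Gamma (1 - β) := Gamma_pos_of_pos (by linarith)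
  set a := (Gamma (1 + β))⁻¹ with ha
  have ha0 : 0 < a := by positivity
  set b := Gamma (1 - β)
  refine ⟨((2 : ℝ) ^ (α / 2) * (1 + (w * a)⁻¹)) ^ 2, (1 + w * b) ^ 2, by positivity,
    by positivity, fun l => ?_⟩
  set p := |l| ^ α with hp
  have hp0 : 0 ≤ p := by positivity
  have hz : 0 ≤ w * p := by positivity
  have hE := mittagLeffler_neg_nonneg hβ hβ1 hz
  have hU := mittagLeffler_neg_upper hβ hβ1 hz
  have hL := mittagLeffler_neg_lower hβ hβ1 hz
  set e := mittagLeffler β (-(w * p))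
  set v := (1 + l ^ 2) ^ (α / 2) with hv
  have hW : 0 < 1 + l ^ 2 := by positivity
  have hv0 : 0 < v := by positivity
  have hα2 : 0 ≤ α / 2 := by linarith
  have hWv : (1 + l ^ 2) ^ (-α) = (v ^ 2)⁻¹ := by
    rw [rpow_neg hW.le, hv, ← rpow_mul_natCast hW.le]
    norm_num
  have hsq : ∀ x : ℝ, 0 ≤ x → (x ^ 2) ^ (α / 2) = x ^ α := fun x hx => by
    rw [← rpow_natCast, ← rpow_mul hx]
    congr 1
    push_cast
    ring
  have hv1 : 1 ≤ v := one_le_rpow (by nlinarith [sq_nonneg l]) hα2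
  have hpv : p ≤ v := by
    rw [hp, ← hsq _ (abs_nonneg l), sq_abs]
    exact rpow_le_rpow (sq_nonneg l) (by linarith) hα2
  have hvp : v ≤ 2 ^ (α / 2) * (1 + p) := by
    have hm : (max 1 |l|) ^ α ≤ 1 + p := by
      rcases max_cases 1 |l| with ⟨h, -⟩ | ⟨h, -⟩
      · rw [h, one_rpow]; linarith
      · rw [h]; linarith
    calc v ≤ (2 * (max 1 |l|) ^ 2) ^ (α / 2) := by
          refine rpow_le_rpow hW.le ?_ hα2
          have h1 : (1 : ℝ) ^ 2 ≤ (max 1 |l|) ^ 2 := by gcongr; exact le_max_left _ _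
          have h2 : |l| ^ 2 ≤ (max 1 |l|) ^ 2 := by gcongr; exact le_max_right _ _
          rw [sq_abs] at h2
          linarith
      _ = 2 ^ (α / 2) * (max 1 |l|) ^ α := by
          rw [mul_rpow (by norm_num) (by positivity), hsq _ (by positivity)]
      _ ≤ _ := by gcongr
  have hup : e * v ≤ 2 ^ (α / 2) * (1 + (w * a)⁻¹) := by
    have h1 : 1 + p ≤ (1 + (w * a)⁻¹) * (1 + w * p * a) := by
      have h2 : (w * a)⁻¹ * (w * p * a) = p := by field_simp
      have h3 : 0 ≤ (w * a)⁻¹ := by positivity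
      have h4 : 0 ≤ w * p * a := by positivity
      linarith
    calc e * v ≤ e * (2 ^ (α / 2) * ((1 + (w * a)⁻¹) * (1 + w * p * a))) := by
          gcongr
          exact hvp.trans (by gcongr)
      _ = 2 ^ (α / 2) * (1 + (w * a)⁻¹) * (e * (1 + w * p * a)) := by ring
      _ ≤ 2 ^ (α / 2) * (1 + (w * a)⁻¹) * 1 := by gcongr
      _ = _ := mul_one _
  have hlow : 1 ≤ (1 + w * b) * e * v := by
    refine hL.trans ?_
    have : 1 + w * p * b ≤ (1 + w * b) * v := by
      have h1 : w * b * p ≤ w * b * v := by gcongr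
      linarith
    calc e * (1 + w * p * b) ≤ e * ((1 + w * b) * v) := by gcongr
      _ = _ := by ring
  rw [hWv]
  constructor
  · rw [← div_eq_mul_inv, le_div_iff₀ (by positivity), ← mul_pow]
    gcongr
  · rw [inv_le_iff_one_le_mul₀ (by positivity), ← mul_pow, ← mul_pow]
    exact one_le_pow₀ hlow

/-- A nonnegative integrand `G` comparable to `F` satisfies `∫ G ≤ K ∫ F`, whether or not `F`
is integrable. -/
lemma integral_le_mul_integral_of_comparable {X : Type*} [MeasurableSpace X] {ν : Measure X}
    {F G : X → ℝ} {K L : ℝ} (hK : 0 ≤ K) (hF : AEStronglyMeasurable F ν) (hF0 : ∀ x, 0 ≤ F x)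
    (hGF : ∀ x, G x ≤ K * F x) (hFG : ∀ x, F x ≤ L * G x) :
    ∫ x, G x ∂ν ≤ K * ∫ x, F x ∂ν := by
  by_cases hG : Integrable G ν
  · have hFi : Integrable F ν := (hG.const_mul L).mono' hF <| ae_of_all _ fun x => by
      rw [Real.norm_of_nonneg (hF0 x)]
      exact hFG x
    rw [← integral_const_mul]
    exact integral_mono hG (hFi.const_mul K) hGF
  · rw [integral_undef hG]
    exact mul_nonneg hK (integral_nonneg hF0)

/-- Spatial mean-square Hölder continuity of the limit field of Theorem 3.2:
if the weighted negative Sobolev norm of kernel differences is Hölder of order `θ*`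
in the second variable, then so is the mean-square increment of the limit field. -/
theorem limit_field_spatial_holder_classical
    (β μ α κ₀ : ℝ) (hβ : β ∈ Set.Ioo (0 : ℝ) 1) (hμ : 0 < μ) (hα : 0 ≤ α)
    (hκ₀ : κ₀ ∈ Set.Ioo (0 : ℝ) 1)
    (g : ℝ → ℝ → ℂ) (hg : Measurable (Function.uncurry g))
    (θs C₀ : ℝ) (hθs : θs ∈ Set.Ioc (0 : ℝ) 1) (hC₀ : 0 < C₀)
    (hHolder : ∀ x y : ℝ,
      ∫ l : ℝ, ‖g l x - g l y‖ ^ 2 * (1 + l ^ 2) ^ (-α) * |l| ^ (κ₀ - 1) ≤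
        C₀ * |x - y| ^ (2 * θs)) :
    ∀ t : ℝ, 0 < t → ∃ C : ℝ, 0 < C ∧ ∀ x y : ℝ,
      ∫ l : ℝ, ‖g l x - g l y‖ ^ 2 * (mittagLeffler β (-(μ * t ^ β * |l| ^ α))) ^ 2 *
          |l| ^ (κ₀ - 1) ≤
        C * |x - y| ^ (2 * θs) := by
  intro t ht
  obtain ⟨K, L, hK, hL, hcmp⟩ := exists_mittagLeffler_sq_comparable (w := μ * t ^ β) hβ.1 hβ.2
    (by positivity) hα
  refine ⟨K * C₀, by positivity, fun x y => ?_⟩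
  have hmeas : ∀ c, Measurable fun l => g l c := fun c =>
    hg.comp (measurable_id.prodMk measurable_const)
  have hx := hmeas x
  have hy := hmeas y
  rw [mul_assoc]
  refine le_trans ?_ (mul_le_mul_of_nonneg_left (hHolder x y) hK.le)
  refine integral_le_mul_integral_of_comparable (L := L) hK.le ?_ (fun l => by positivity)
    (fun l => ?_) (fun l => ?_)
  · refine Measurable.aestronglyMeasurable ?_
    fun_prop
  · have h : 0 ≤ ‖g l x - g l y‖ ^ 2 * |l| ^ (κ₀ - 1) := by positivity
    have := mul_le_mul_of_nonneg_left (hcmp l).1 h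
    linarith
  · have h : 0 ≤ ‖g l x - g l y‖ ^ 2 * |l| ^ (κ₀ - 1) := by positivity
    have := mul_le_mul_of_nonneg_left (hcmp l).2 h
    linarith
end

section
/- Let α ≥ 0 and ν > 0, and set p = α + 2ν + 1. There exists a constant C > 0 such that for all u ∈ (0,1]: (i) if 2α + 4ν < 1 then ∫_ℝ min(λ²u², 1) (1+λ²)^{−p} dλ ≤ C u^{2α+4ν+1}; (ii) if 2α + 4ν = 1 then ∫_ℝ min(λ²u², 1) (1+λ²)^{−p} dλ ≤ C u² (1 − log u); (iii) if 2α + 4ν > 1 then ∫_ℝ min(λ²u², 1) (1+λ²)^{−p} dλ ≤ C u². -/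
open Real MeasureTheory

theorem continuous_min_mul_rpow (p u : ℝ) :
    Continuous fun l : ℝ => min (l ^ 2 * u ^ 2) 1 * (1 + l ^ 2) ^ (-p) := by
  refine Continuous.mul (by fun_prop) ?_
  exact Continuous.rpow_const (by fun_prop) fun l => Or.inl (by positivity)

theorem one_add_sq_rpow_neg_le {p l : ℝ} (hp : 0 ≤ p) (hl : 0 < l) :
    (1 + l ^ 2) ^ (-p) ≤ l ^ (-(2 * p)) := by
  calc (1 + l ^ 2) ^ (-p) ≤ (l ^ 2) ^ (-p) :=
        rpow_le_rpow_of_nonpos (by positivity) (by linarith) (by linarith)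
    _ = l ^ (-(2 * p)) := by
        rw [← rpow_natCast, ← rpow_mul hl.le]; congr 1; push_cast; ring

theorem integrable_one_add_sq_rpow_neg {p : ℝ} (hp : 1 / 2 < p) :
    Integrable fun l : ℝ => (1 + l ^ 2) ^ (-p) := by
  have h := integrable_rpow_neg_one_add_norm_sq (E := ℝ) (μ := volume) (r := 2 * p)
    (by simp; linarith)
  refine h.congr (Filter.Eventually.of_forall fun l => ?_)
  simp only [norm_eq_abs, sq_abs]
  congr 1; ring

theorem integrable_min_mul_rpow {p : ℝ} (u : ℝ) (hp : 1 / 2 < p) :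
    Integrable fun l : ℝ => min (l ^ 2 * u ^ 2) 1 * (1 + l ^ 2) ^ (-p) := by
  refine (integrable_one_add_sq_rpow_neg hp).mono'
    (continuous_min_mul_rpow p u).aestronglyMeasurable (Filter.Eventually.of_forall fun l => ?_)
  rw [norm_of_nonneg (by positivity)]
  exact mul_le_of_le_one_left (by positivity) (min_le_right _ _)

theorem integral_Ioi_inv_min_mul_rpow_le {p u : ℝ} (hp : 1 / 2 < p) (hu : 0 < u) :
    ∫ l in Set.Ioi u⁻¹, min (l ^ 2 * u ^ 2) 1 * (1 + l ^ 2) ^ (-p) ≤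
      u ^ (2 * p - 1) / (2 * p - 1) := by
  have hu' : 0 < u⁻¹ := inv_pos.2 hu
  calc _ ≤ ∫ l in Set.Ioi u⁻¹, l ^ (-(2 * p)) := by
        refine setIntegral_mono_on (integrable_min_mul_rpow u hp).integrableOn
          (integrableOn_Ioi_rpow_of_lt (by linarith) hu') measurableSet_Ioi fun l hl => ?_
        have hl : 0 < l := hu'.trans hl
        exact (mul_le_of_le_one_left (by positivity) (min_le_right _ _)).trans
          (one_add_sq_rpow_neg_le (by linarith) hl)
    _ = u ^ (2 * p - 1) / (2 * p - 1) := by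
        rw [integral_Ioi_rpow_of_lt (by linarith) hu', inv_rpow hu.le, ← rpow_neg hu.le,
          show -(-(2 * p) + 1) = 2 * p - 1 by ring,
          show -(2 * p) + 1 = -(2 * p - 1) by ring, neg_div_neg_eq]

/-- The integral over the line is twice the one over the half-line, split at `u⁻¹`. -/
theorem integral_min_mul_rpow_le {p u : ℝ} (hp : 1 / 2 < p) (hu : 0 < u) :
    ∫ l : ℝ, min (l ^ 2 * u ^ 2) 1 * (1 + l ^ 2) ^ (-p) ≤
      2 * (u ^ 2 * (∫ l in (0 : ℝ)..u⁻¹, l ^ 2 * (1 + l ^ 2) ^ (-p)) +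
        u ^ (2 * p - 1) / (2 * p - 1)) := by
  have hu' : 0 < u⁻¹ := inv_pos.2 hu
  have heven := integral_comp_abs
    (f := fun l : ℝ => min (l ^ 2 * u ^ 2) 1 * (1 + l ^ 2) ^ (-p))
  simp only [sq_abs] at heven
  rw [heven, ← intervalIntegral.integral_interval_add_Ioi (b := u⁻¹)
    (integrable_min_mul_rpow u hp).integrableOn (integrable_min_mul_rpow u hp).integrableOn]
  gcongr
  · rw [← intervalIntegral.integral_const_mul]
    refine intervalIntegral.integral_mono_on hu'.le
      ((continuous_min_mul_rpow p u).intervalIntegrable _ _)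
      (Continuous.intervalIntegrable ?_ _ _) fun l _ => ?_
    · refine continuous_const.mul (Continuous.mul (by fun_prop) ?_)
      exact Continuous.rpow_const (by fun_prop) fun l => Or.inl (by positivity)
    · rw [← mul_assoc, mul_comm (u ^ 2)]
      gcongr
      exact min_le_left _ _
  · exact integral_Ioi_inv_min_mul_rpow_le hp hu

theorem continuous_sq_mul_rpow (p : ℝ) :
    Continuous fun l : ℝ => l ^ 2 * (1 + l ^ 2) ^ (-p) := by
  refine Continuous.mul (by fun_prop) ?_
  exact Continuous.rpow_const (by fun_prop) fun l => Or.inl (by positivity)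

theorem sq_mul_rpow_le {p l : ℝ} (hp : 0 ≤ p) (hl : 0 < l) :
    l ^ 2 * (1 + l ^ 2) ^ (-p) ≤ l ^ (2 - 2 * p) := by
  calc _ ≤ l ^ 2 * l ^ (-(2 * p)) := by gcongr; exact one_add_sq_rpow_neg_le hp hl
    _ = l ^ (2 - 2 * p) := by
        rw [← rpow_natCast, ← rpow_add hl]; congr 1

theorem integral_min_mul_rpow_le_of_lt {p u : ℝ} (hp : 1 / 2 < p) (hp' : p < 3 / 2)
    (hu : 0 < u) :
    ∫ l : ℝ, min (l ^ 2 * u ^ 2) 1 * (1 + l ^ 2) ^ (-p) ≤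
      2 * (1 / (3 - 2 * p) + 1 / (2 * p - 1)) * u ^ (2 * p - 1) := by
  have hu' : 0 < u⁻¹ := inv_pos.2 hu
  have hhead : ∫ l in (0 : ℝ)..u⁻¹, l ^ 2 * (1 + l ^ 2) ^ (-p) ≤
      u ^ (2 * p - 3) / (3 - 2 * p) := by
    calc _ ≤ ∫ l in (0 : ℝ)..u⁻¹, l ^ (2 - 2 * p) :=
          intervalIntegral.integral_mono_on_of_le_Ioo hu'.le
            ((continuous_sq_mul_rpow p).intervalIntegrable _ _)
            (intervalIntegral.intervalIntegrable_rpow' (by linarith))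
            fun l hl => sq_mul_rpow_le (by linarith) hl.1
      _ = u ^ (2 * p - 3) / (3 - 2 * p) := by
          rw [integral_rpow (Or.inl (by linarith)), zero_rpow (by linarith), sub_zero,
            inv_rpow hu.le, ← rpow_neg hu.le]
          ring_nf
  refine (integral_min_mul_rpow_le hp hu).trans ?_
  have hpow : u ^ (2 * p - 1) = u ^ 2 * u ^ (2 * p - 3) := by
    rw [← rpow_natCast, ← rpow_add hu]; congr 1; push_cast; ring
  calc _ ≤ 2 * (u ^ 2 * (u ^ (2 * p - 3) / (3 - 2 * p)) + u ^ (2 * p - 1) / (2 * p - 1)) := by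
        gcongr
    _ = _ := by rw [hpow]; ring

theorem integral_min_mul_rpow_le_log {u : ℝ} (hu : u ∈ Set.Ioc (0 : ℝ) 1) :
    ∫ l : ℝ, min (l ^ 2 * u ^ 2) 1 * (1 + l ^ 2) ^ (-(3 / 2) : ℝ) ≤
      3 * u ^ 2 * (1 - log u) := by
  obtain ⟨hu0, hu1⟩ := hu
  have hu' : 1 ≤ u⁻¹ := (one_le_inv₀ hu0).2 hu1
  have hcont := continuous_sq_mul_rpow (3 / 2)
  have hnear : ∫ l in (0 : ℝ)..1, l ^ 2 * (1 + l ^ 2) ^ (-(3 / 2) : ℝ) ≤ 1 := by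
    calc _ ≤ ∫ l in (0 : ℝ)..1, (1 : ℝ) := by
          refine intervalIntegral.integral_mono_on zero_le_one (hcont.intervalIntegrable _ _)
            intervalIntegrable_const fun l hl => ?_
          exact mul_le_one₀ (pow_le_one₀ hl.1 hl.2) (by positivity)
            (rpow_le_one_of_one_le_of_nonpos (by nlinarith) (by norm_num))
      _ = 1 := by simp
  have hfar : ∫ l in (1 : ℝ)..u⁻¹, l ^ 2 * (1 + l ^ 2) ^ (-(3 / 2) : ℝ) ≤ -log u := by
    calc _ ≤ ∫ l in (1 : ℝ)..u⁻¹, l⁻¹ := by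
          refine intervalIntegral.integral_mono_on hu' (hcont.intervalIntegrable _ _)
            (intervalIntegral.intervalIntegrable_inv (fun l hl => ?_) continuousOn_id)
            fun l hl => ?_
          · rw [Set.uIcc_of_le hu'] at hl
            exact (zero_lt_one.trans_le hl.1).ne'
          · refine (sq_mul_rpow_le (by norm_num) (zero_lt_one.trans_le hl.1)).trans_eq ?_
            rw [show (2 - 2 * (3 / 2) : ℝ) = -1 by norm_num, rpow_neg_one]
      _ = -log u := by
          rw [integral_inv_of_pos one_pos (by positivity), div_one, log_inv]
  have hsplit := intervalIntegral.integral_add_adjacent_intervals (μ := volume)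
    (hcont.intervalIntegrable 0 1) (hcont.intervalIntegrable 1 u⁻¹)
  have hmain := integral_min_mul_rpow_le (p := 3 / 2) (by norm_num) hu0
  rw [← hsplit, show (2 * (3 / 2) - 1 : ℝ) = (2 : ℕ) by norm_num, rpow_natCast] at hmain
  refine hmain.trans ?_
  have hlog := log_nonpos hu0.le hu1
  push_cast
  nlinarith [sq_nonneg u]

theorem integral_min_mul_rpow_le_of_gt {p : ℝ} (u : ℝ) (hp : 3 / 2 < p) :
    ∫ l : ℝ, min (l ^ 2 * u ^ 2) 1 * (1 + l ^ 2) ^ (-p) ≤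
      (∫ l : ℝ, (1 + l ^ 2) ^ (-(p - 1))) * u ^ 2 := by
  rw [← integral_mul_const]
  refine integral_mono (integrable_min_mul_rpow u (by linarith))
    ((integrable_one_add_sq_rpow_neg (by linarith)).mul_const _) fun l => ?_
  have hl : (0 : ℝ) < 1 + l ^ 2 := by positivity
  calc min (l ^ 2 * u ^ 2) 1 * (1 + l ^ 2) ^ (-p)
      ≤ ((1 + l ^ 2) * u ^ 2) * (1 + l ^ 2) ^ (-p) := by
        gcongr
        exact (min_le_left _ _).trans (by gcongr; linarith)
    _ = (1 + l ^ 2) ^ (-(p - 1)) * u ^ 2 := by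
        rw [show -(p - 1) = 1 + -p by ring, rpow_add hl, rpow_one]; ring

open Real MeasureTheory

/-- Estimates for the integral `∫_ℝ min(λ²u², 1)(1+λ²)^{-(α+2ν+1)} dλ` in the three
regimes `2α+4ν < 1`, `2α+4ν = 1`, `2α+4ν > 1`. -/
theorem min_integral_estimates (α ν : ℝ) (hα : 0 ≤ α) (hν : 0 < ν) :
    ∃ C : ℝ, 0 < C ∧ ∀ u : ℝ, u ∈ Set.Ioc (0 : ℝ) 1 →
      (2 * α + 4 * ν < 1 →
        ∫ l : ℝ, min (l ^ 2 * u ^ 2) 1 * (1 + l ^ 2) ^ (-(α + 2 * ν + 1)) ≤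
          C * u ^ (2 * α + 4 * ν + 1)) ∧
      (2 * α + 4 * ν = 1 →
        ∫ l : ℝ, min (l ^ 2 * u ^ 2) 1 * (1 + l ^ 2) ^ (-(α + 2 * ν + 1)) ≤
          C * u ^ 2 * (1 - Real.log u)) ∧
      (1 < 2 * α + 4 * ν →
        ∫ l : ℝ, min (l ^ 2 * u ^ 2) 1 * (1 + l ^ 2) ^ (-(α + 2 * ν + 1)) ≤
          C * u ^ 2) := by
  rcases lt_trichotomy (2 * α + 4 * ν) 1 with h | h | h
  · have h1 : 0 < 3 - 2 * (α + 2 * ν + 1) := by linarith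
    have h2 : 0 < 2 * (α + 2 * ν + 1) - 1 := by linarith
    refine ⟨2 * (1 / (3 - 2 * (α + 2 * ν + 1)) + 1 / (2 * (α + 2 * ν + 1) - 1)),
      by positivity, fun u hu => ⟨fun _ => ?_, fun h' => by linarith, fun h' => by linarith⟩⟩
    refine (integral_min_mul_rpow_le_of_lt (by linarith) (by linarith) hu.1).trans_eq ?_
    congr 2; ring
  · refine ⟨3, by norm_num, fun u hu =>
      ⟨fun h' => by linarith, fun _ => ?_, fun h' => by linarith⟩⟩
    rw [show α + 2 * ν + 1 = 3 / 2 by linarith]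
    exact integral_min_mul_rpow_le_log hu
  · have hC : 0 ≤ ∫ l : ℝ, (1 + l ^ 2) ^ (-(α + 2 * ν + 1 - 1)) :=
      integral_nonneg fun l => by positivity
    refine ⟨(∫ l : ℝ, (1 + l ^ 2) ^ (-(α + 2 * ν + 1 - 1))) + 1, by positivity, fun u _ =>
      ⟨fun h' => by linarith, fun h' => by linarith, fun _ => ?_⟩⟩
    refine (integral_min_mul_rpow_le_of_gt u (by linarith)).trans ?_
    gcongr
    linarith
end

section
/- Let β ∈ (0,1), μ > 0, α ≥ 0, t₀ > 0, x₀ ∈ ℝ, and let ĝ : ℝ × ℝ → ℂ be measurable. Suppose there exists M > 0 such that ∫_ℝ |ĝ(λ,y)| dy ≤ M for almost every λ ∈ ℝ, and suppose ∫_ℝ |ĝ(λ,x₀)| (E_β(−μ t₀^β |λ|^α))² dλ < ∞. Then ∫_ℝ ∫_ℝ |ĝ(λ,x₀)| · |ĝ(λ,x₀+h)| · (E_β(−μ t₀^β |λ|^α))² dλ dh < ∞. (Since |Cov(U₀^g(t₀,x₀), U₀^g(t₀,x₀+h))| is bounded by a constant times the inner integral, this states that the limit field U₀^g is short-range dependent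 in space at (x₀,t₀); the same argument applies to Ũ₀^g.) -/
open Real MeasureTheory

/-- A weight of finite mass times a kernel whose sections have uniformly bounded `L¹` norm has
finite double integral after translating the kernel in its second variable. -/
theorem lintegral_lintegral_mul_translate_lt_top {w : ℝ → ENNReal} (hw : AEMeasurable w)
    (hw_fin : ∫⁻ l, w l ≠ ⊤) {k : ℝ → ℝ → ENNReal} (hk : Measurable (Function.uncurry k))
    {C : ENNReal} (hC : C ≠ ⊤) (hkC : ∀ᵐ l : ℝ, ∫⁻ y, k l y ≤ C) (x : ℝ) :
    ∫⁻ h, ∫⁻ l, w l * k l (x + h) < ⊤ := by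
  have hk' : Measurable fun p : ℝ × ℝ => k p.2 (x + p.1) :=
    hk.comp (measurable_snd.prodMk (measurable_fst.const_add x))
  have hmeas : AEMeasurable (Function.uncurry fun h l => w l * k l (x + h))
      ((volume : Measure ℝ).prod volume) :=
    hw.comp_snd.mul hk'.aemeasurable
  rw [lintegral_lintegral_swap hmeas]
  calc ∫⁻ l, ∫⁻ h, w l * k l (x + h)
      ≤ ∫⁻ l, w l * C := by
        refine lintegral_mono_ae ?_
        filter_upwards [hkC] with l hl
        have hkl : Measurable fun h => k l (x + h) :=
          hk.comp (measurable_const.prodMk (measurable_id.const_add x))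
        rw [lintegral_const_mul _ hkl, lintegral_add_left_eq_self (k l) x]
        gcongr
    _ = (∫⁻ l, w l) * C := lintegral_mul_const' _ _ hC
    _ < ⊤ := ENNReal.mul_lt_top hw_fin.lt_top hC.lt_top

/-- Short-range dependence in space of the limit field: if `∫_ℝ |ĝ(λ,y)| dy ≤ M` for
a.e. `λ` and `∫_ℝ |ĝ(λ,x₀)| (E_β(-μt₀^β|λ|^α))² dλ < ∞`, then the spatial integral of
the covariance bound is finite. -/
theorem limit_field_short_range_dependence_in_space
    (β μ α t₀ x₀ : ℝ) (hβ : β ∈ Set.Ioo (0 : ℝ) 1) (hμ : 0 < μ) (hα : 0 ≤ α)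
    (ht₀ : 0 < t₀)
    (g : ℝ → ℝ → ℂ) (hg : Measurable (Function.uncurry g))
    (M : ℝ) (hM : 0 < M)
    (hgL1 : ∀ᵐ l : ℝ, (∫⁻ y : ℝ, ENNReal.ofReal ‖g l y‖) ≤ ENNReal.ofReal M)
    (hgx₀ : Integrable
      (fun l : ℝ => ‖g l x₀‖ * (mittagLeffler β (-(μ * t₀ ^ β * |l| ^ α))) ^ 2)) :
    ∫⁻ h : ℝ, ∫⁻ l : ℝ,
        ENNReal.ofReal (‖g l x₀‖ * ‖g l (x₀ + h)‖ *
          (mittagLeffler β (-(μ * t₀ ^ β * |l| ^ α))) ^ 2) < ⊤ := by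
  have h := lintegral_lintegral_mul_translate_lt_top hgx₀.aemeasurable.ennreal_ofReal
    hgx₀.lintegral_lt_top.ne (k := fun l y => ENNReal.ofReal ‖g l y‖) hg.norm.ennreal_ofReal
    ENNReal.ofReal_ne_top hgL1 x₀
  convert h using 5 with h l
  rw [← ENNReal.ofReal_mul (by positivity)]
  congr 1
  ring
end

section
/- Let μ > 0, t₀ > 0 and ν > 0. The function h ↦ ∫_ℝ e^{−iλh} e^{−2μt₀|λ|} (1 + λ²)^{−(2ν+1)} dλ belongs to L¹(ℝ); that is, ∫_ℝ | ∫_ℝ cos(λh) e^{−2μt₀|λ|} (1+λ²)^{−(2ν+1)} dλ | dh < ∞. (For the fractional Riesz–Bessel equation with α = β = 1 and the Matérn kernel with a = 1, this function is, up to a positive constant, the spatial covariance h ↦ Cov(U₀^g(t₀,x₀), U₀^g(t₀,x₀+h)) of the limit field, since E₁(z) = e^z; hence the limit field is short-range dependent in space at (x₀,t₀).) -/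
open Real MeasureTheory

open Filter Topology Set

/-- Integrating by parts twice in a cosine transform on the half-line. -/
lemma sq_mul_integral_Ioi_cos_mul {φ φ' φ'' : ℝ → ℝ} (hφ : ∀ x, HasDerivAt φ (φ' x) x)
    (hφ' : ∀ x, HasDerivAt φ' (φ'' x) x) (hi : IntegrableOn φ (Ioi 0))
    (hi'' : IntegrableOn φ'' (Ioi 0)) (ht : Tendsto φ atTop (𝓝 0))
    (ht' : Tendsto φ' atTop (𝓝 0)) (h : ℝ) :
    h ^ 2 * ∫ l in Ioi 0, cos (l * h) * φ l =
      -φ' 0 - ∫ l in Ioi 0, cos (l * h) * φ'' l := by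
  have cos_mul_integrable : ∀ f : ℝ → ℝ, IntegrableOn f (Ioi 0) →
      IntegrableOn (fun l => cos (l * h) * f l) (Ioi 0) := fun f hf =>
    hf.bdd_mul (c := 1) (by fun_prop) (ae_of_all _ fun l => abs_cos_le_one _)
  have hderiv : ∀ l, HasDerivAt (fun l => h * (sin (l * h) * φ l) + cos (l * h) * φ' l)
      (h ^ 2 * (cos (l * h) * φ l) + cos (l * h) * φ'' l) l := by
    intro l
    have hl : HasDerivAt (fun l : ℝ => l * h) h l := by simpa using (hasDerivAt_id l).mul_const h
    refine (((hl.sin.mul (hφ l)).const_mul h).add (hl.cos.mul (hφ' l))).congr_deriv ?_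
    ring
  have hlim : Tendsto (fun l => h * (sin (l * h) * φ l) + cos (l * h) * φ' l) atTop (𝓝 0) := by
    have hsin : Tendsto (fun l => sin (l * h) * φ l) atTop (𝓝 0) := by
      refine squeeze_zero_norm (fun l => ?_) (tendsto_zero_iff_norm_tendsto_zero.1 ht)
      rw [norm_mul]
      exact mul_le_of_le_one_left (norm_nonneg _) (abs_sin_le_one _)
    have hcos : Tendsto (fun l => cos (l * h) * φ' l) atTop (𝓝 0) := by
      refine squeeze_zero_norm (fun l => ?_) (tendsto_zero_iff_norm_tendsto_zero.1 ht')
      rw [norm_mul]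
      exact mul_le_of_le_one_left (norm_nonneg _) (abs_cos_le_one _)
    simpa using (hsin.const_mul h).add hcos
  have key := integral_Ioi_of_hasDerivAt_of_tendsto' (a := 0) (fun l _ => hderiv l)
    (((cos_mul_integrable φ hi).const_mul _).add (cos_mul_integrable φ'' hi'')) hlim
  rw [integral_add ((cos_mul_integrable φ hi).const_mul _) (cos_mul_integrable φ'' hi''),
    integral_const_mul] at key
  simp only [zero_mul, sin_zero, cos_zero, mul_zero, one_mul, zero_add, zero_sub] at key
  linarith

lemma abs_integral_Ioi_cos_mul_le {f : ℝ → ℝ} (hf : IntegrableOn f (Ioi 0)) (h : ℝ) :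
    |∫ l in Ioi 0, cos (l * h) * f l| ≤ ∫ l in Ioi 0, |f l| := by
  rw [← norm_eq_abs]
  refine norm_integral_le_of_norm_le hf.norm (ae_of_all _ fun l => ?_)
  rw [norm_mul]
  exact mul_le_of_le_one_left (norm_nonneg _) (abs_cos_le_one _)

/-- The cosine transform of an integrable function on the half-line with integrable second
derivative is integrable. -/
lemma integrable_integral_Ioi_cos_mul {φ φ' φ'' : ℝ → ℝ} (hφ : ∀ x, HasDerivAt φ (φ' x) x)
    (hφ' : ∀ x, HasDerivAt φ' (φ'' x) x) (hi : IntegrableOn φ (Ioi 0))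
    (hi'' : IntegrableOn φ'' (Ioi 0)) (ht : Tendsto φ atTop (𝓝 0))
    (ht' : Tendsto φ' atTop (𝓝 0)) :
    Integrable (fun h : ℝ => ∫ l in Ioi 0, cos (l * h) * φ l) := by
  have hcont : Continuous φ := continuous_iff_continuousAt.2 fun x => (hφ x).continuousAt
  have hmeas : AEStronglyMeasurable (fun h : ℝ => ∫ l in Ioi 0, cos (l * h) * φ l) := by
    have hc : Continuous (fun p : ℝ × ℝ => cos (p.2 * p.1) * φ p.2) := by fun_prop
    exact (hc.stronglyMeasurable.integral_prod_right'
      (ν := volume.restrict (Ioi 0))).aestronglyMeasurable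
  refine (integrable_inv_one_add_sq.const_mul
    ((∫ l in Ioi 0, |φ l|) + (|φ' 0| + ∫ l in Ioi 0, |φ'' l|))).mono' hmeas
    (ae_of_all _ fun h => ?_)
  rw [← div_eq_mul_inv, le_div_iff₀ (by positivity), norm_eq_abs]
  have h₀ := abs_integral_Ioi_cos_mul_le hi h
  have h₂ : |∫ l in Ioi 0, cos (l * h) * φ l| * h ^ 2 ≤ |φ' 0| + ∫ l in Ioi 0, |φ'' l| := by
    rw [mul_comm, ← abs_of_nonneg (sq_nonneg h), ← abs_mul,
      sq_mul_integral_Ioi_cos_mul hφ hφ' hi hi'' ht ht']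
    refine (abs_sub _ _).trans ?_
    rw [abs_neg]
    gcongr
    exact abs_integral_Ioi_cos_mul_le hi'' h
  linarith

lemma integrableOn_Ioi_of_abs_le_exp {f : ℝ → ℝ} {c K : ℝ} (hc : 0 < c) (hf : Continuous f)
    (hle : ∀ x, 0 ≤ x → |f x| ≤ K * exp (-c * x)) : IntegrableOn f (Ioi 0) :=
  ((exp_neg_integrableOn_Ioi 0 hc).const_mul K).mono' hf.aestronglyMeasurable
    ((ae_restrict_mem measurableSet_Ioi).mono fun x hx => hle x (le_of_lt hx))

lemma tendsto_atTop_zero_of_abs_le_exp {f : ℝ → ℝ} {c K : ℝ} (hc : 0 < c)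
    (hle : ∀ x, 0 ≤ x → |f x| ≤ K * exp (-c * x)) : Tendsto f atTop (𝓝 0) := by
  refine squeeze_zero_norm' ((eventually_ge_atTop 0).mono hle) ?_
  have : Tendsto (fun x : ℝ => exp (-c * x)) atTop (𝓝 0) :=
    tendsto_exp_atBot.comp (tendsto_id.const_mul_atTop_of_neg (neg_lt_zero.2 hc))
  simpa using this.const_mul K

lemma hasDerivAt_one_add_sq_rpow (p x : ℝ) :
    HasDerivAt (fun x : ℝ => (1 + x ^ 2) ^ p) (2 * p * x * (1 + x ^ 2) ^ (p - 1)) x := by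
  have h : HasDerivAt (fun x : ℝ => 1 + x ^ 2) (2 * x) x := by
    simpa using (hasDerivAt_pow 2 x).const_add 1
  convert h.rpow_const (p := p) (Or.inl (by positivity)) using 1
  ring

lemma hasDerivAt_exp_neg_mul (c x : ℝ) :
    HasDerivAt (fun x : ℝ => exp (-c * x)) (-c * exp (-c * x)) x := by
  have h : HasDerivAt (fun x : ℝ => -c * x) (-c) x := by
    simpa using (hasDerivAt_id x).const_mul (-c)
  convert h.exp using 1
  ring

lemma one_add_sq_rpow_le_one {p : ℝ} (hp : p ≤ 0) (x : ℝ) : (1 + x ^ 2) ^ p ≤ 1 :=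
  rpow_le_one_of_one_le_of_nonpos (by nlinarith [sq_nonneg x]) hp

lemma mul_one_add_sq_rpow_sub_one_le_one {p : ℝ} (hp : p ≤ 0) (x : ℝ) :
    x * (1 + x ^ 2) ^ (p - 1) ≤ 1 := by
  have hpos : (0 : ℝ) < 1 + x ^ 2 := by positivity
  rw [rpow_sub_one hpos.ne', mul_div_assoc', div_le_one hpos]
  have h₀ : 0 ≤ (1 + x ^ 2) ^ p := by positivity
  have h₁ := one_add_sq_rpow_le_one hp x
  rcases le_total x 0 with hx | hx
  · nlinarith
  · nlinarith [sq_nonneg (x - 1)]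

lemma sq_mul_one_add_sq_rpow_sub_one_le_one {p : ℝ} (hp : p ≤ 0) (x : ℝ) :
    x ^ 2 * (1 + x ^ 2) ^ (p - 1) ≤ 1 := by
  have hpos : (0 : ℝ) < 1 + x ^ 2 := by positivity
  rw [rpow_sub_one hpos.ne', mul_div_assoc', div_le_one hpos]
  nlinarith [one_add_sq_rpow_le_one hp x, sq_nonneg x]

/-- The cosine transform of `l ↦ e^{-cl} (1 + l²)^{-s}` on the half-line is integrable. -/
lemma integrable_integral_Ioi_cos_mul_exp_mul_rpow {c s : ℝ} (hc : 0 < c) (hs : 0 ≤ s) :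
    Integrable (fun h : ℝ =>
      ∫ l in Ioi 0, cos (l * h) * (exp (-c * l) * (1 + l ^ 2) ^ (-s))) := by
  have hrpow : ∀ p : ℝ, Continuous fun l : ℝ => (1 + l ^ 2) ^ p := fun p =>
    continuous_iff_continuousAt.2 fun x => (hasDerivAt_one_add_sq_rpow p x).continuousAt
  have b₀ (p : ℝ) (l : ℝ) : 0 ≤ (1 + l ^ 2) ^ p := by positivity
  have bound : ∀ l : ℝ, |exp (-c * l) * (1 + l ^ 2) ^ (-s)| ≤ 1 * exp (-c * l) := by
    intro l
    rw [abs_of_nonneg (by positivity), mul_comm]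
    gcongr
    exact one_add_sq_rpow_le_one (by linarith) l
  have bound' : ∀ l : ℝ, 0 ≤ l → |exp (-c * l) *
      (-c * (1 + l ^ 2) ^ (-s) - 2 * s * (l * (1 + l ^ 2) ^ (-s - 1)))| ≤
      (c + 2 * s) * exp (-c * l) := by
    intro l hl
    rw [abs_mul, abs_of_nonneg (exp_pos _).le, mul_comm]
    gcongr
    have h₁ := mul_le_mul_of_nonneg_left (one_add_sq_rpow_le_one (p := -s) (by linarith) l) hc.le
    have h₂ := mul_le_mul_of_nonneg_left
      (mul_one_add_sq_rpow_sub_one_le_one (p := -s) (by linarith) l) hs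
    have h₃ := mul_nonneg hc.le (b₀ (-s) l)
    have h₄ := mul_nonneg hs (mul_nonneg hl (b₀ (-s - 1) l))
    rw [abs_le]
    constructor <;> linarith
  have bound'' : ∀ l : ℝ, 0 ≤ l → |exp (-c * l) *
      (c ^ 2 * (1 + l ^ 2) ^ (-s) + 4 * (c * s) * (l * (1 + l ^ 2) ^ (-s - 1))
        - 2 * s * (1 + l ^ 2) ^ (-s - 1)
        + 4 * (s * (s + 1)) * (l ^ 2 * (1 + l ^ 2) ^ (-s - 1 - 1)))| ≤
      (c ^ 2 + 4 * (c * s) + 2 * s + 4 * (s * (s + 1))) * exp (-c * l) := by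
    intro l hl
    rw [abs_mul, abs_of_nonneg (exp_pos _).le, mul_comm]
    gcongr
    have h₁ := mul_le_mul_of_nonneg_left
      (one_add_sq_rpow_le_one (p := -s) (by linarith) l) (sq_nonneg c)
    have hcs : 0 ≤ c * s := by positivity
    have hss : 0 ≤ s * (s + 1) := by positivity
    have h₂ := mul_le_mul_of_nonneg_left
      (mul_one_add_sq_rpow_sub_one_le_one (p := -s) (by linarith) l) hcs
    have h₃ := mul_le_mul_of_nonneg_left
      (one_add_sq_rpow_le_one (p := -s - 1) (by linarith) l) hs
    have h₄ := mul_le_mul_of_nonneg_left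
      (sq_mul_one_add_sq_rpow_sub_one_le_one (p := -s - 1) (by linarith) l) hss
    have h₅ := mul_nonneg (sq_nonneg c) (b₀ (-s) l)
    have h₆ := mul_nonneg hcs (mul_nonneg hl (b₀ (-s - 1) l))
    have h₇ := mul_nonneg hs (b₀ (-s - 1) l)
    have h₈ := mul_nonneg hss (mul_nonneg (sq_nonneg l) (b₀ (-s - 1 - 1) l))
    rw [abs_le]
    constructor <;> linarith
  refine integrable_integral_Ioi_cos_mul (fun l => ?_) (fun l => ?_)
    (integrableOn_Ioi_of_abs_le_exp hc ?_ fun l _ => bound l)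
    (integrableOn_Ioi_of_abs_le_exp hc ?_ bound'')
    (tendsto_atTop_zero_of_abs_le_exp hc fun l _ => bound l)
    (tendsto_atTop_zero_of_abs_le_exp hc bound')
  · refine ((hasDerivAt_exp_neg_mul c l).mul (hasDerivAt_one_add_sq_rpow (-s) l)).congr_deriv ?_
    ring
  · refine ((hasDerivAt_exp_neg_mul c l).mul
      (((hasDerivAt_one_add_sq_rpow (-s) l).const_mul (-c)).sub
        (((hasDerivAt_id l).mul (hasDerivAt_one_add_sq_rpow (-s - 1) l)).const_mul (2 * s)))).congr_deriv ?_
    simp only [Pi.sub_apply, Pi.mul_apply, id]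
    ring
  · have := hrpow (-s)
    fun_prop
  · have := hrpow (-s)
    have := hrpow (-s - 1)
    have := hrpow (-s - 1 - 1)
    fun_prop

/-- The spatial covariance of the limit field in the Matérn case with
`α = β = a = 1` is integrable in the spatial lag:
`h ↦ ∫_ℝ cos(λh) e^{-2μt₀|λ|}(1+λ²)^{-(2ν+1)} dλ` belongs to `L¹(ℝ)`. -/
theorem matern_spatial_covariance_integrable
    (μ t₀ ν : ℝ) (hμ : 0 < μ) (ht₀ : 0 < t₀) (hν : 0 < ν) :
    Integrable (fun h : ℝ =>
      ∫ l : ℝ, Real.cos (l * h) * Real.exp (-(2 * μ * t₀ * |l|)) *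
        (1 + l ^ 2) ^ (-(2 * ν + 1))) := by
  have hc : 0 < 2 * μ * t₀ := by positivity
  have hs : 0 ≤ 2 * ν + 1 := by positivity
  refine ((integrable_integral_Ioi_cos_mul_exp_mul_rpow hc hs).const_mul 2).congr
    (ae_of_all _ fun h => ?_)
  simp only
  rw [← integral_comp_abs
    (f := fun l => cos (l * h) * (exp (-(2 * μ * t₀) * l) * (1 + l ^ 2) ^ (-(2 * ν + 1))))]
  refine integral_congr_ae (ae_of_all _ fun l => ?_)
  have hcos : cos (|l| * h) = cos (l * h) := by
    rcases abs_choice l with hl | hl <;> simp [hl]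
  simp only [hcos, sq_abs, neg_mul, mul_assoc]
end

section
/- Let a > 0, α ≥ 0 and ν > 0 with 2α + 4ν ≠ 1, and set θ = min(1, α + 2ν + 1/2). Then there exists a constant C > 0 such that for all x, y ∈ ℝ, I(x,y) := ∫_ℝ |e^{iλx} − e^{iλy}|² (1 + λ²)^{−α} (a² + λ²)^{−(2ν+1)} dλ ≤ C |x − y|^{2θ}. (Consequently, for the Matérn kernel the Hölder hypothesis of Theorem 4.2 holds for the limit field U₀^g with exponent θ = min(1, α + 2ν + 1/2).) -/
open Real MeasureTheory

/-- The oscillatory increment is bounded both trivially and by the Lipschitz estimate. -/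
lemma norm_exp_sub_exp_sq_le (l x y : ℝ) :
    ‖Complex.exp (Complex.I * l * x) - Complex.exp (Complex.I * l * y)‖ ^ 2 ≤
      min 4 (|(x - y) * l| ^ 2) := by
  have h : ‖Complex.exp (Complex.I * l * x) - Complex.exp (Complex.I * l * y)‖ =
      2 * |Real.sin ((x - y) * l / 2)| := by
    have h1 : Complex.exp (Complex.I * l * x) - Complex.exp (Complex.I * l * y) =
        Complex.exp ((l * y : ℝ) * Complex.I) *
          (Complex.exp (Complex.I * ((x - y) * l : ℝ)) - 1) := by
      rw [mul_sub, ← Complex.exp_add, mul_one]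
      push_cast
      congr 2 <;> ring
    rw [h1, norm_mul, Complex.norm_exp_ofReal_mul_I, one_mul,
      Complex.norm_exp_I_mul_ofReal_sub_one]
    simp
  rw [h]
  refine le_min ?_ ?_
  · nlinarith [Real.abs_sin_le_one ((x - y) * l / 2), abs_nonneg (Real.sin ((x - y) * l / 2))]
  · refine pow_le_pow_left₀ (by positivity) ?_ 2
    have := Real.abs_sin_le_abs (x := (x - y) * l / 2)
    rw [abs_div, Nat.abs_ofNat] at this
    linarith

lemma integrable_min_mul_abs_rpow {s : ℝ} (h1 : 1 < s) (h3 : s < 3) :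
    Integrable fun u : ℝ ↦ min 4 (|u| ^ 2) * |u| ^ (-s) := by
  have key := integrable_fun_norm_addHaar (E := ℝ) volume
    (f := fun t : ℝ ↦ min 4 (t ^ 2) * t ^ (-s))
  simp only [Real.norm_eq_abs] at key
  rw [key]
  simp only [Module.finrank_self, Nat.sub_self, pow_zero, one_smul]
  have hmeas : Measurable fun t : ℝ ↦ min 4 (t ^ 2) * t ^ (-s) := by fun_prop
  rw [← Set.Ioc_union_Ioi_eq_Ioi zero_le_one]
  refine IntegrableOn.union ?_ ?_
  · have hi : IntegrableOn (fun t : ℝ ↦ t ^ (2 - s)) (Set.Ioc 0 1) :=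
      (intervalIntegrable_iff_integrableOn_Ioc_of_le zero_le_one).1
        (intervalIntegral.intervalIntegrable_rpow' (by linarith))
    refine hi.mono' hmeas.aestronglyMeasurable ?_
    filter_upwards [ae_restrict_mem measurableSet_Ioc] with t ht
    have ht0 : 0 < t := ht.1
    rw [Real.norm_of_nonneg (by positivity), sub_eq_add_neg, Real.rpow_add ht0, Real.rpow_two]
    gcongr
    exact min_le_right _ _
  · refine ((integrableOn_Ioi_rpow_of_lt (a := -s) (by linarith) one_pos).const_mul 4).mono'
      hmeas.aestronglyMeasurable ?_
    filter_upwards [ae_restrict_mem measurableSet_Ioi] with t ht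
    have ht0 : 0 < t := one_pos.trans ht
    rw [Real.norm_of_nonneg (by positivity)]
    gcongr
    exact min_le_left _ _

lemma weight_le_abs_rpow {a p q l : ℝ} (hp : 0 ≤ p) (hq : 0 ≤ q) (hl : l ≠ 0) :
    (1 + l ^ 2) ^ (-p) * (a ^ 2 + l ^ 2) ^ (-q) ≤ |l| ^ (-(2 * p + 2 * q)) := by
  have hl0 : 0 < |l| := abs_pos.2 hl
  have hl2 : 0 < l ^ 2 := by positivity
  calc (1 + l ^ 2) ^ (-p) * (a ^ 2 + l ^ 2) ^ (-q)
      ≤ (l ^ 2) ^ (-p) * (l ^ 2) ^ (-q) := by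
        gcongr ?_ * ?_
        · exact Real.rpow_le_rpow_of_nonpos hl2 (by linarith) (by linarith)
        · exact Real.rpow_le_rpow_of_nonpos hl2 (by nlinarith [sq_nonneg a]) (by linarith)
    _ = |l| ^ (-(2 * p + 2 * q)) := by
        rw [← Real.rpow_add hl2, ← sq_abs, ← Real.rpow_two, ← Real.rpow_mul hl0.le]
        ring_nf

lemma sq_mul_weight_le {a p q : ℝ} (ha : 0 < a) (hq : 0 ≤ q) (l : ℝ) :
    l ^ 2 * ((1 + l ^ 2) ^ (-p) * (a ^ 2 + l ^ 2) ^ (-q)) ≤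
      (min 1 (a ^ 2)) ^ (-q) * (1 + ‖l‖ ^ 2) ^ (-(2 * p + 2 * q - 2) / 2) := by
  have hm : 0 < min 1 (a ^ 2) := lt_min one_pos (by positivity)
  have h1 : 0 < 1 + l ^ 2 := by positivity
  have hle : min 1 (a ^ 2) * (1 + l ^ 2) ≤ a ^ 2 + l ^ 2 := by
    nlinarith [min_le_left 1 (a ^ 2), min_le_right 1 (a ^ 2), sq_nonneg l]
  calc l ^ 2 * ((1 + l ^ 2) ^ (-p) * (a ^ 2 + l ^ 2) ^ (-q))
      ≤ (1 + l ^ 2) * ((1 + l ^ 2) ^ (-p) * (min 1 (a ^ 2) * (1 + l ^ 2)) ^ (-q)) := by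
        gcongr ?_ * (_ * ?_)
        · linarith
        · exact Real.rpow_le_rpow_of_nonpos (by positivity) hle (by linarith)
    _ = (min 1 (a ^ 2)) ^ (-q) * (1 + ‖l‖ ^ 2) ^ (-(2 * p + 2 * q - 2) / 2) := by
        rw [Real.mul_rpow hm.le h1.le, Real.norm_eq_abs, sq_abs,
          show -(2 * p + 2 * q - 2) / 2 = 1 + -p + -q by ring, Real.rpow_add h1,
          Real.rpow_add h1, Real.rpow_one]
        ring

/-- Hölder estimate for the Matérn-kernel Sobolev increment integral:
`I(x,y) = ∫_ℝ |e^{iλx} - e^{iλy}|² (1+λ²)^{-α} (a²+λ²)^{-(2ν+1)} dλ ≤ C|x-y|^{2θ}`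
with `θ = min(1, α + 2ν + 1/2)`, provided `2α + 4ν ≠ 1`. -/
theorem matern_spatial_holder_estimate
    (a α ν : ℝ) (ha : 0 < a) (hα : 0 ≤ α) (hν : 0 < ν)
    (hne : 2 * α + 4 * ν ≠ 1) :
    ∃ C : ℝ, 0 < C ∧ ∀ x y : ℝ,
      ∫ l : ℝ, ‖Complex.exp (Complex.I * l * x) - Complex.exp (Complex.I * l * y)‖ ^ 2 *
          (1 + l ^ 2) ^ (-α) * (a ^ 2 + l ^ 2) ^ (-(2 * ν + 1)) ≤
        C * |x - y| ^ (2 * min 1 (α + 2 * ν + 1 / 2)) := by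
  set s : ℝ := 2 * α + 2 * (2 * ν + 1) with hs
  rcases lt_or_gt_of_ne hne with hlt | hgt
  · have hg := integrable_min_mul_abs_rpow (s := s) (by linarith) (by linarith)
    set J : ℝ := ∫ u : ℝ, min 4 (|u| ^ 2) * |u| ^ (-s) with hJ
    have hJ0 : 0 ≤ J := integral_nonneg fun u ↦ by positivity
    refine ⟨J + 1, by linarith, fun x y ↦ ?_⟩
    rw [min_eq_right (by linarith), show 2 * (α + 2 * ν + 1 / 2) = s - 1 by rw [hs]; ring]
    rcases eq_or_ne x y with rfl | hxy
    · simp only [sub_self, norm_zero]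
      simp only [ne_eq, OfNat.ofNat_ne_zero, not_false_eq_true, zero_pow, zero_mul, integral_zero]
      positivity
    have hh : x - y ≠ 0 := sub_ne_zero.2 hxy
    have hh0 : 0 < |x - y| := abs_pos.2 hh
    calc _ ≤ ∫ l : ℝ, |x - y| ^ s *
            (min 4 (|(x - y) * l| ^ 2) * |(x - y) * l| ^ (-s)) := by
          refine integral_mono_of_nonneg (.of_forall fun l ↦ ?_)
            ((hg.comp_mul_left' hh).const_mul _) (.of_forall fun l ↦ ?_)
          · simp only [Pi.zero_apply]
            positivity
          · rcases eq_or_ne l 0 with rfl | hl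
            · simp
            dsimp only
            have hw := weight_le_abs_rpow (a := a) hα (by linarith : 0 ≤ 2 * ν + 1) hl
            have he : |x - y| ^ s * |(x - y) * l| ^ (-s) = |l| ^ (-s) := by
              rw [abs_mul, Real.mul_rpow hh0.le (abs_nonneg l), ← mul_assoc,
                ← Real.rpow_add hh0, add_neg_cancel, Real.rpow_zero, one_mul]
            rw [mul_left_comm, he, mul_assoc]
            exact mul_le_mul (norm_exp_sub_exp_sq_le l x y) hw (by positivity) (by positivity)
      _ = J * |x - y| ^ (s - 1) := by
          rw [integral_const_mul,
            Measure.integral_comp_mul_left (fun u : ℝ ↦ min 4 (|u| ^ 2) * |u| ^ (-s)),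
            smul_eq_mul, ← hJ, abs_inv, Real.rpow_sub_one hh0.ne']
          ring
      _ ≤ (J + 1) * |x - y| ^ (s - 1) := by
          gcongr
          linarith
  · have hg := (integrable_rpow_neg_one_add_norm_sq (E := ℝ) (μ := volume) (r := s - 2)
      (by rw [Module.finrank_self]; push_cast; linarith)).const_mul
        ((min 1 (a ^ 2)) ^ (-(2 * ν + 1)))
    set J : ℝ := ∫ l : ℝ, (min 1 (a ^ 2)) ^ (-(2 * ν + 1)) *
      (1 + ‖l‖ ^ 2) ^ (-(s - 2) / 2) with hJ
    have hJ0 : 0 ≤ J := integral_nonneg fun u ↦ by positivity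
    refine ⟨J + 1, by linarith, fun x y ↦ ?_⟩
    rw [min_eq_left (by linarith), mul_one, Real.rpow_two]
    calc _ ≤ ∫ l : ℝ, |x - y| ^ 2 * ((min 1 (a ^ 2)) ^ (-(2 * ν + 1)) *
            (1 + ‖l‖ ^ 2) ^ (-(s - 2) / 2)) := by
          refine integral_mono_of_nonneg (.of_forall fun l ↦ ?_)
            (hg.const_mul _) (.of_forall fun l ↦ ?_)
          · simp only [Pi.zero_apply]
            positivity
          · dsimp only
            have hw := sq_mul_weight_le (p := α) ha (by linarith : 0 ≤ 2 * ν + 1) l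
            have he := (norm_exp_sub_exp_sq_le l x y).trans (min_le_right _ _)
            rw [abs_mul, mul_pow, sq_abs l] at he
            calc _ ≤ |x - y| ^ 2 * l ^ 2 *
                    ((1 + l ^ 2) ^ (-α) * (a ^ 2 + l ^ 2) ^ (-(2 * ν + 1))) := by
                  rw [mul_assoc]
                  gcongr
              _ ≤ _ := by
                  rw [mul_assoc]
                  gcongr
      _ = J * |x - y| ^ 2 := by
          rw [integral_const_mul, ← hJ, mul_comm]
      _ ≤ (J + 1) * |x - y| ^ 2 := by
          gcongr
          linarith
end
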